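/- There is an absolute constant C > 0 such that for every δ > 0 and every integer t ≥ 3 there exists m₀ = m₀(δ,t) with the following property: every δ-expander H on m ≥ m₀ vertices contains a K_t-minor of order at most C·(t²/δ)·log m·(log log m)³. -/

import Mathlib

open Real

/-- Edge density `d(G) = |E(G)|/|V(G)|`. -/
noncomputable def density {V : Type*} (G : SimpleGraph V) : ℝ :=
  G.edgeSet.ncard / Nat.card V

/-- External neighborhood `N(S)`: vertices outside `S` adjacent to some vertex of `S`. -/
def nbhd {V : Type*} (G : SimpleGraph V) (S : Set V) : Set V :=
  {v | v ∉ S ∧ ∃ u ∈ S, G.Adj u v}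

/-- `G` contains a `K_t`-minor (branch sets are disjoint, nonempty, connected,
pairwise joined by an edge). -/
def HasKtMinor {V : Type*} (G : SimpleGraph V) (t : ℕ) : Prop :=
  ∃ P : Fin t → Set V,
    (∀ i, (P i).Nonempty) ∧
    (Pairwise (Function.onFun Disjoint P)) ∧
    (∀ i, (G.induce (P i)).Connected) ∧
    (∀ i j : Fin t, i < j → ∃ u ∈ P i, ∃ v ∈ P j, G.Adj u v)

/-- `G` contains a `K_t`-minor of order at most `k`. -/
def HasKtMinorOfOrder {V : Type*} (G : SimpleGraph V) (t : ℕ) (k : ℝ) : Prop :=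
  ∃ P : Fin t → Set V,
    (∀ i, (P i).Nonempty) ∧
    (Pairwise (Function.onFun Disjoint P)) ∧
    (∀ i, (G.induce (P i)).Connected) ∧
    (∀ i j : Fin t, i < j → ∃ u ∈ P i, ∃ v ∈ P j, G.Adj u v) ∧
    ((⋃ i, P i).ncard : ℝ) ≤ k

/-- `c(t)`: the least `c` such that every graph of density at least `c` has a `K_t`-minor. -/
noncomputable def minorThreshold (t : ℕ) : ℝ :=
  sInf {c : ℝ | ∀ (n : ℕ) (G : SimpleGraph (Fin n)), density G ≥ c → HasKtMinor G t}

/-- `δ`-expander. -/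
def IsDeltaExpander {V : Type*} (G : SimpleGraph V) (δ : ℝ) : Prop :=
  ∀ d : ℕ, (d : ℝ) ≤ logb 2 (logb 2 (Nat.card V)) - 1 →
    ∀ S : Set V, (S.ncard : ℝ) ≤ (Nat.card V : ℝ) / (2 : ℝ) ^ (2 ^ d : ℕ) →
      ((nbhd G S).ncard : ℝ) ≥
        δ * 2 ^ d / (logb 2 (Nat.card V) * (logb 2 (logb 2 (Nat.card V))) ^ 2) * S.ncard

/-- `(δ, n)`-expander. -/
def IsDeltaNExpander {V : Type*} (G : SimpleGraph V) (δ : ℝ) (n : ℕ) : Prop :=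
  ∀ d : ℕ, (d : ℝ) ≤ logb 2 (logb 2 (Nat.card V)) - 1 →
    ∀ S : Set V, (S.ncard : ℝ) ≤ (Nat.card V : ℝ) / (2 : ℝ) ^ (2 ^ d : ℕ) →
      ((nbhd G S).ncard : ℝ) ≥ δ * 2 ^ d / logb 2 n * S.ncard

/-- `B_k(v)`: ball of radius `k` around the vertex `v`. -/
def gball {V : Type*} (G : SimpleGraph V) (v : V) (k : ℕ) : Set V :=
  {u | ∃ p : G.Walk v u, p.length ≤ k}

/-- `B_k(U)`: ball of radius `k` around the vertex set `U`. -/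
def gballSet {V : Type*} (G : SimpleGraph V) (U : Set V) (k : ℕ) : Set V :=
  {v | ∃ u ∈ U, ∃ p : G.Walk u v, p.length ≤ k}

/-- A graph `H` is a `γ`-expanding ball: it is covered by a ball `B_k(v)` all of whose
intermediate balls expand by a factor `1 + γ`. -/
def GraphIsExpandingBall {V : Type*} (H : SimpleGraph V) (γ : ℝ) : Prop :=
  ∃ (v : V) (k : ℕ), gball H v k = Set.univ ∧
    ∀ i : ℕ, 1 ≤ i → i + 1 ≤ k →
      ((gball H v (i + 1)).ncard : ℝ) ≥ (1 + γ) * (gball H v i).ncard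

section AvoidBall

variable {V : Type*} (G : SimpleGraph V)

/-- The vertices that can be reached from `A` in at most `n` steps, all of which end outside the
forbidden set `F`. -/
def avoidBall (F A : Set V) : ℕ → Set V
  | 0 => A
  | n + 1 => avoidBall F A n ∪ (nbhd G (avoidBall F A n) \ F)

variable {G} {F A : Set V}

lemma avoidBall_succ (n : ℕ) :
    avoidBall G F A (n + 1) = avoidBall G F A n ∪ (nbhd G (avoidBall G F A n) \ F) := rfl

lemma avoidBall_monotone : Monotone (avoidBall G F A) :=
  monotone_nat_of_le_succ fun _ => Set.subset_union_left

lemma subset_avoidBall (n : ℕ) : A ⊆ avoidBall G F A n :=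
  avoidBall_monotone (Nat.zero_le n)

lemma avoidBall_add (r n : ℕ) :
    avoidBall G F (avoidBall G F A r) n = avoidBall G F A (r + n) := by
  induction n with
  | zero => rfl
  | succ n ih => rw [avoidBall_succ, ih, ← add_assoc, avoidBall_succ]

lemma mem_avoidBall_succ_of_adj {n : ℕ} {x y : V} (hy : y ∈ avoidBall G F A n) (h : G.Adj y x)
    (hx : x ∉ F) : x ∈ avoidBall G F A (n + 1) := by
  by_cases hx' : x ∈ avoidBall G F A n
  · exact Or.inl hx'
  · exact Or.inr ⟨⟨hx', y, hy, h⟩, hx⟩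

lemma avoidBall_subset_avoidBall {F' A' : Set V} (hF : F' ⊆ F) (hA : A ⊆ A') (n : ℕ) :
    avoidBall G F A n ⊆ avoidBall G F' A' n := by
  induction n with
  | zero => exact hA
  | succ n ih =>
    rintro x (hx | ⟨⟨-, y, hy, hyx⟩, hx⟩)
    · exact Or.inl (ih hx)
    · exact mem_avoidBall_succ_of_adj (ih hy) hyx fun h => hx (hF h)

lemma notMem_of_mem_avoidBall {n : ℕ} {x : V} (hx : x ∈ avoidBall G F A n) (hxA : x ∉ A) :
    x ∉ F := by
  induction n with
  | zero => exact absurd hx hxA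
  | succ n ih =>
    rcases hx with hx | hx
    · exact ih hx
    · exact hx.2

lemma mem_avoidBall_singleton_comm {n : ℕ} {u x : V} (hu : u ∉ F)
    (hx : x ∈ avoidBall G F {u} n) : u ∈ avoidBall G F {x} n := by
  induction n generalizing x with
  | zero => exact (Set.mem_singleton_iff.1 hx) ▸ Set.mem_singleton _
  | succ n ih =>
    rcases hx with hx | ⟨⟨-, y, hy, hyx⟩, hx⟩
    · exact Or.inl (ih hx)
    · have hyF : y ∉ F := by
        by_cases hyu : y = u
        · exact hyu ▸ hu
        · exact notMem_of_mem_avoidBall hy hyu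
      have hy' : y ∈ avoidBall G F {x} 1 :=
        mem_avoidBall_succ_of_adj (n := 0) (Set.mem_singleton x) hyx.symm hyF
      rw [add_comm, ← avoidBall_add]
      exact avoidBall_subset_avoidBall subset_rfl (Set.singleton_subset_iff.2 hy') n (ih hy)

lemma exists_connected_of_mem_avoidBall {n : ℕ} {x : V} (hx : x ∈ avoidBall G F A n) :
    ∃ a ∈ A, ∃ Y ⊆ avoidBall G F A n, a ∈ Y ∧ x ∈ Y ∧ (G.induce Y).Connected ∧
      Y.Finite ∧ Y.ncard ≤ n + 1 ∧ ∀ y ∈ Y, y ≠ a → y ∉ F := by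
  induction n generalizing x with
  | zero =>
    refine ⟨x, hx, {x}, Set.singleton_subset_iff.2 hx, rfl, rfl, ?_, Set.finite_singleton x,
      by simp, fun y hy hya => absurd hy hya⟩
    rw [SimpleGraph.induce_singleton_eq_top]
    exact SimpleGraph.connected_top
  | succ n ih =>
    rcases hx with hx | ⟨⟨hxn, y, hy, hyx⟩, hx⟩
    · obtain ⟨a, ha, Y, hY, h1, h2, h3, h4, h5, h6⟩ := ih hx
      exact ⟨a, ha, Y, hY.trans Set.subset_union_left, h1, h2, h3, h4, by omega, h6⟩
    · obtain ⟨a, ha, Y, hY, h1, h2, h3, h4, h5, h6⟩ := ih hy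
      refine ⟨a, ha, Y ∪ {y, x}, ?_, Or.inl h1, by simp, ?_, h4.union (by simp), ?_, ?_⟩
      · rintro z (hz | rfl | rfl)
        · exact Or.inl (hY hz)
        · exact Or.inl hy
        · exact mem_avoidBall_succ_of_adj hy hyx hx
      · exact SimpleGraph.induce_union_connected h3.preconnected
          (SimpleGraph.induce_pair_connected_of_adj hyx).preconnected ⟨y, h2, by simp⟩
      · have : Y ∪ {y, x} = insert x Y := by
          ext z
          simp only [Set.mem_union, Set.mem_insert_iff, Set.mem_singleton_iff]
          grind
        rw [this]
        exact (Set.ncard_insert_le _ _).trans (by omega)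
      · rintro z (hz | rfl | rfl) hza
        · exact h6 z hz hza
        · exact h6 z h2 hza
        · exact hx

/-- Two intersecting balls around sets which avoid these sets produce disjoint connected sets,
joined by an edge, which leave the forbidden set immediately. -/
lemma exists_linked_of_avoidBall_inter {B : Set V} (hAF : A ⊆ F) (hAB : Disjoint A B) {N N' : ℕ}
    (h : (avoidBall G F A N ∩ avoidBall G F B N').Nonempty) :
    ∃ a ∈ A, ∃ b ∈ B, ∃ Y Z : Set V, a ∈ Y ∧ b ∈ Z ∧ (G.induce Y).Connected ∧
      (G.induce Z).Connected ∧ Y.ncard ≤ N + 1 ∧ Z.ncard ≤ N' + 1 ∧ Disjoint Y Z ∧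
      (∀ y ∈ Y, y ≠ a → y ∉ F) ∧ (∀ z ∈ Z, z ≠ b → z ∉ F) ∧ ∃ y ∈ Y, ∃ z ∈ Z, G.Adj y z := by
  induction N with
  | zero =>
    obtain ⟨x, hx, hx'⟩ := h
    by_cases hxB : x ∈ B
    · exact absurd hxB (Set.disjoint_left.1 hAB hx)
    · exact absurd (hAF hx) (notMem_of_mem_avoidBall hx' hxB)
  | succ n ih =>
    by_cases hn : (avoidBall G F A n ∩ avoidBall G F B N').Nonempty
    · obtain ⟨a, ha, b, hb, Y, Z, h1, h2, h3, h4, h5, h6⟩ := ih hn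
      exact ⟨a, ha, b, hb, Y, Z, h1, h2, h3, h4, by omega, h6⟩
    · obtain ⟨x, hx, hx'⟩ := h
      rcases hx with hx | ⟨⟨hxn, y, hy, hyx⟩, hx⟩
      · exact absurd ⟨x, hx, hx'⟩ hn
      · obtain ⟨a, ha, Y, hY, h1, h2, h3, -, h5, h6⟩ := exists_connected_of_mem_avoidBall hy
        obtain ⟨b, hb, Z, hZ, k1, k2, k3, -, k5, k6⟩ := exists_connected_of_mem_avoidBall hx'
        exact ⟨a, ha, b, hb, Y, Z, h1, k1, h3, k3, by omega, k5,
          (Set.disjoint_iff_inter_eq_empty.2 (Set.not_nonempty_iff_eq_empty.1 hn)).mono hY hZ,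
          h6, k6, y, h2, x, k2, hyx⟩

lemma ncard_avoidBall_succ [Finite V] (n : ℕ) :
    (avoidBall G F A n).ncard + (nbhd G (avoidBall G F A n)).ncard ≤
      (avoidBall G F A (n + 1)).ncard + (nbhd G (avoidBall G F A n) ∩ F).ncard := by
  rw [avoidBall_succ, Set.ncard_union_eq,
    ← Set.ncard_inter_add_ncard_sdiff_eq_ncard (nbhd G (avoidBall G F A n)) F]
  · omega
  · exact Set.disjoint_right.2 fun x hx => hx.1.1

lemma ncard_nbhd_le [Finite V] {S : Set V} {Δ : ℕ} (h : ∀ v ∈ S, (nbhd G {v}).ncard ≤ Δ) :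
    (nbhd G S).ncard ≤ S.ncard * Δ := by
  have hsub : nbhd G S ⊆ ⋃ v ∈ S.toFinite.toFinset, nbhd G {v} := by
    rintro x ⟨hx, u, hu, hux⟩
    simp only [Set.Finite.mem_toFinset, Set.mem_iUnion]
    exact ⟨u, hu, hux.ne', u, rfl, hux⟩
  calc (nbhd G S).ncard ≤ _ := Set.ncard_le_ncard hsub
    _ ≤ ∑ v ∈ S.toFinite.toFinset, (nbhd G {v}).ncard := Finset.set_ncard_biUnion_le _ _
    _ ≤ ∑ v ∈ S.toFinite.toFinset, Δ := Finset.sum_le_sum fun v hv => h v (by simpa using hv)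
    _ = S.ncard * Δ := by rw [Finset.sum_const, smul_eq_mul, Set.ncard_eq_toFinset_card S]

lemma ncard_avoidBall_singleton_le [Finite V] {Δ : ℕ} {v : V} (hv : v ∉ F)
    (h : ∀ u ∉ F, (nbhd G {u}).ncard ≤ Δ) (n : ℕ) :
    (avoidBall G F {v} n).ncard ≤ (Δ + 1) ^ n := by
  induction n with
  | zero => simp [avoidBall]
  | succ n ih =>
    have h1 : (nbhd G (avoidBall G F {v} n)).ncard ≤ (avoidBall G F {v} n).ncard * Δ := by
      refine ncard_nbhd_le fun u hu => h u ?_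
      by_cases huv : u = v
      · exact huv ▸ hv
      · exact notMem_of_mem_avoidBall hu huv
    have h2 := Set.ncard_le_ncard
      (Set.sdiff_subset : nbhd G (avoidBall G F {v} n) \ F ⊆ nbhd G (avoidBall G F {v} n))
    calc (avoidBall G F {v} (n + 1)).ncard ≤ _ := Set.ncard_union_le _ _
      _ ≤ (avoidBall G F {v} n).ncard * (Δ + 1) := by rw [mul_add_one]; omega
      _ ≤ (Δ + 1) ^ (n + 1) := by rw [pow_succ]; gcongr

lemma nbhd_avoidBall_subset_or_lt_ncard [Finite V] (hA : A.Nonempty) (n : ℕ) :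
    nbhd G (avoidBall G F A n) ⊆ F ∨ n + 1 ≤ (avoidBall G F A n).ncard := by
  induction n with
  | zero => exact Or.inr ((Set.ncard_pos A.toFinite).2 hA)
  | succ n ih =>
    by_cases hn : nbhd G (avoidBall G F A n) ⊆ F
    · left
      have : avoidBall G F A (n + 1) = avoidBall G F A n := by
        rw [avoidBall_succ, Set.sdiff_eq_empty.2 hn, Set.union_empty]
      rwa [this]
    · right
      obtain ⟨x, hx, hxF⟩ := Set.not_subset.1 hn
      have hlt : (avoidBall G F A n).ncard < (avoidBall G F A (n + 1)).ncard :=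
        Set.ncard_lt_ncard ⟨avoidBall_monotone n.le_succ, fun h => hx.1 (h (Or.inr ⟨hx, hxF⟩))⟩
      have := ih.resolve_left hn
      omega

end AvoidBall

section Links

variable {V : Type*} {G : SimpleGraph V} {t : ℕ}

/-- The sets `Y` and `Z` are disjoint connected sets of size at most `K`, joined by an edge, which
meet the union of the cores `Q` only in a vertex of `Q i` and of `Q j`, respectively. -/
structure IsLink (G : SimpleGraph V) (Q : Fin t → Set V) (K : ℕ) (i j : Fin t)
    (Y Z : Set V) : Prop where
  connected_left : (G.induce Y).Connected
  connected_right : (G.induce Z).Connected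
  ncard_left_le : Y.ncard ≤ K
  ncard_right_le : Z.ncard ≤ K
  disjoint : Disjoint Y Z
  exists_adj : ∃ y ∈ Y, ∃ z ∈ Z, G.Adj y z
  nonempty_left : (Y ∩ Q i).Nonempty
  nonempty_right : (Z ∩ Q j).Nonempty
  inter_left_subset : Y ∩ ⋃ k, Q k ⊆ Q i
  inter_right_subset : Z ∩ ⋃ k, Q k ⊆ Q j

/-- Links between pairs of cores can be chosen greedily so as to be disjoint outside the cores. -/
lemma exists_disjoint_links [Finite V] {Q : Fin t → Set V} {K : ℕ}
    (hlink : ∀ U : Set V, U.ncard ≤ t ^ 2 * (2 * K) → Disjoint U (⋃ k, Q k) →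
      ∀ i j, i < j → ∃ Y Z, IsLink G Q K i j Y Z ∧ Disjoint (Y ∪ Z) U)
    (E : Finset (Fin t × Fin t)) (hE : ∀ e ∈ E, e.1 < e.2) :
    ∃ Y Z : Fin t × Fin t → Set V, (∀ e ∈ E, IsLink G Q K e.1 e.2 (Y e) (Z e)) ∧
      ∀ e ∈ E, ∀ e' ∈ E, e ≠ e' →
        Disjoint ((Y e ∪ Z e) \ ⋃ k, Q k) ((Y e' ∪ Z e') \ ⋃ k, Q k) := by
  classical
  induction E using Finset.induction_on with
  | empty => exact ⟨fun _ => ∅, fun _ => ∅, by simp, by simp⟩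
  | insert p E hp ih =>
    obtain ⟨Y, Z, h1, h2⟩ := ih fun e he => hE e (Finset.mem_insert_of_mem he)
    set U : Set V := ⋃ e ∈ E, (Y e ∪ Z e) \ ⋃ k, Q k with hU
    have hcard : U.ncard ≤ t ^ 2 * (2 * K) := by
      calc U.ncard ≤ ∑ e ∈ E, ((Y e ∪ Z e) \ ⋃ k, Q k).ncard := Finset.set_ncard_biUnion_le _ _
        _ ≤ ∑ e ∈ E, 2 * K := by
          refine Finset.sum_le_sum fun e he => ?_
          have := Set.ncard_le_ncard (Set.sdiff_subset : (Y e ∪ Z e) \ ⋃ k, Q k ⊆ Y e ∪ Z e)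
          have := Set.ncard_union_le (Y e) (Z e)
          have := (h1 e he).ncard_left_le
          have := (h1 e he).ncard_right_le
          omega
        _ = E.card * (2 * K) := by simp
        _ ≤ t ^ 2 * (2 * K) := by
          gcongr
          simpa [sq] using Finset.card_le_univ E
    have hdisj : Disjoint U (⋃ k, Q k) := by
      rw [hU, Set.disjoint_iUnion₂_left]
      exact fun e _ => Set.disjoint_sdiff_left
    obtain ⟨Y', Z', hl, hYZ⟩ := hlink U hcard hdisj p.1 p.2 (hE p (Finset.mem_insert_self p E))
    have hne : ∀ e ∈ E, e ≠ p := fun e he h => hp (h ▸ he)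
    have hnew : ∀ e ∈ E, Disjoint ((Y' ∪ Z') \ ⋃ k, Q k) ((Y e ∪ Z e) \ ⋃ k, Q k) := fun e he =>
      hYZ.mono Set.sdiff_subset (Set.subset_biUnion_of_mem (u := fun e => (Y e ∪ Z e) \ ⋃ k, Q k) he)
    refine ⟨Function.update Y p Y', Function.update Z p Z', ?_, ?_⟩
    · intro e he
      rcases Finset.mem_insert.1 he with rfl | he
      · simpa using hl
      · simpa [Function.update_of_ne (hne e he)] using h1 e he
    · intro e he e' he' hee
      rcases Finset.mem_insert.1 he with rfl | hm <;> rcases Finset.mem_insert.1 he' with rfl | hm'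
      · exact absurd rfl hee
      · simpa [Function.update_of_ne (hne e' hm')] using hnew e' hm'
      · simpa [Function.update_of_ne (hne e hm)] using (hnew e hm).symm
      · simpa [Function.update_of_ne (hne e hm), Function.update_of_ne (hne e' hm')] using
          h2 e hm e' hm' hee

/-- If the cores of a family are pairwise linked, robustly under deleting vertices outside the
cores, then there is a complete minor which uses few vertices of the cores. -/
lemma hasKtMinorOfOrder_of_links [Finite V] {Q : Fin t → Set V} {c : Fin t → V} {K R : ℕ}
    (ht : 0 < t) (hR : 1 ≤ R) (hc : ∀ i, c i ∈ Q i) (hQ : Pairwise (Function.onFun Disjoint Q))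
    (hcore : ∀ i, ∀ x ∈ Q i, ∃ Y ⊆ Q i, c i ∈ Y ∧ x ∈ Y ∧ (G.induce Y).Connected ∧ Y.ncard ≤ R)
    (hlink : ∀ U : Set V, U.ncard ≤ t ^ 2 * (2 * K) → Disjoint U (⋃ k, Q k) →
      ∀ i j, i < j → ∃ Y Z, IsLink G Q K i j Y Z ∧ Disjoint (Y ∪ Z) U) :
    HasKtMinorOfOrder G t ((t ^ 2 * (K + R) : ℕ) : ℝ) := by
  classical
  obtain ⟨Y, Z, hYZ, hdisj⟩ := exists_disjoint_links hlink
    (Finset.univ.filter fun e : Fin t × Fin t => e.1 < e.2) (by simp)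
  simp only [Finset.mem_filter, Finset.mem_univ, true_and, Prod.forall] at hYZ hdisj
  let T : Fin t → Fin t → Set V := fun i j =>
    if i < j then Y (i, j) else if j < i then Z (j, i) else {c i}
  have hT1 : ∀ i j, i < j → T i j = Y (i, j) := fun i j h => if_pos h
  have hT2 : ∀ i j, j < i → T i j = Z (j, i) := fun i j h => by
    simp only [T, if_neg h.not_gt, if_pos h]
  have hT3 : ∀ i, T i i = {c i} := fun i => by simp [T]
  have hTS : ∀ i j, ∃ S, c i ∈ S ∧ T i j ⊆ S ∧ S ⊆ T i j ∪ Q i ∧ (G.induce S).Connected ∧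
      S.ncard ≤ K + R := by
    intro i j
    have key : ∀ T : Set V, (G.induce T).Connected → T.ncard ≤ K → (T ∩ Q i).Nonempty →
        ∃ S, c i ∈ S ∧ T ⊆ S ∧ S ⊆ T ∪ Q i ∧ (G.induce S).Connected ∧ S.ncard ≤ K + R := by
      rintro T hT hTK ⟨a, haT, haQ⟩
      obtain ⟨W, hW, h1, h2, h3, h4⟩ := hcore i a haQ
      exact ⟨T ∪ W, Or.inr h1, Set.subset_union_left, Set.union_subset_union_right _ hW,
        SimpleGraph.induce_union_connected hT.preconnected h3.preconnected ⟨a, haT, h2⟩,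
        (Set.ncard_union_le _ _).trans (by omega)⟩
    rcases lt_trichotomy i j with h | rfl | h
    · rw [hT1 i j h]
      have := hYZ i j h
      exact key _ this.connected_left this.ncard_left_le this.nonempty_left
    · rw [hT3]
      refine ⟨{c i}, rfl, subset_rfl, Set.subset_union_left, ?_, by simp; omega⟩
      rw [SimpleGraph.induce_singleton_eq_top]
      exact SimpleGraph.connected_top
    · rw [hT2 i j h]
      have := hYZ j i h
      exact key _ this.connected_right this.ncard_right_le this.nonempty_right
  have hTQ : ∀ i j, T i j ∩ ⋃ k, Q k ⊆ Q i := by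
    intro i j
    rcases lt_trichotomy i j with h | rfl | h
    · rw [hT1 i j h]; exact (hYZ i j h).inter_left_subset
    · rw [hT3]; rintro x ⟨rfl, -⟩; exact hc i
    · rw [hT2 i j h]; exact (hYZ j i h).inter_right_subset
  have hTdisj : ∀ i j i' j', i ≠ i' → ∀ x ∈ T i j, x ∈ T i' j' → x ∈ ⋃ k, Q k := by
    have hYZe : ∀ a b a' b', a < b → a' < b' → (a ≠ a' ∨ b ≠ b') → ∀ x,
        x ∈ Y (a, b) ∪ Z (a, b) → x ∈ Y (a', b') ∪ Z (a', b') → x ∈ ⋃ k, Q k := by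
      intro a b a' b' h h' hne x hx hx'
      by_contra hxQ
      refine Set.disjoint_left.1 (hdisj a b h a' b' h' ?_) ⟨hx, hxQ⟩ ⟨hx', hxQ⟩
      rw [Ne, Prod.mk.injEq]
      tauto
    intro i j i' j' hne x hx hx'
    have hself : ∀ i, x ∈ T i i → x ∈ ⋃ k, Q k := fun i hx => by
      rw [hT3] at hx
      exact Set.mem_iUnion.2 ⟨i, hx ▸ hc i⟩
    rcases lt_trichotomy i j with h | rfl | h
    · rw [hT1 i j h] at hx
      rcases lt_trichotomy i' j' with h' | rfl | h'
      · rw [hT1 _ _ h'] at hx'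
        exact hYZe i j i' j' h h' (Or.inl hne) x (Or.inl hx) (Or.inl hx')
      · exact hself _ hx'
      · rw [hT2 _ _ h'] at hx'
        by_cases hp : i = j' ∧ j = i'
        · obtain ⟨rfl, rfl⟩ := hp
          exact absurd hx' (Set.disjoint_left.1 (hYZ i j h).disjoint hx)
        · exact hYZe i j j' i' h h' (by tauto) x (Or.inl hx) (Or.inr hx')
    · exact hself _ hx
    · rw [hT2 i j h] at hx
      rcases lt_trichotomy i' j' with h' | rfl | h'
      · rw [hT1 _ _ h'] at hx'
        by_cases hp : i = j' ∧ j = i'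
        · obtain ⟨rfl, rfl⟩ := hp
          exact absurd hx (Set.disjoint_left.1 (hYZ j i h).disjoint hx')
        · exact hYZe j i i' j' h h' (by tauto) x (Or.inr hx) (Or.inl hx')
      · exact hself _ hx'
      · rw [hT2 _ _ h'] at hx'
        exact hYZe j i j' i' h h' (Or.inr hne) x (Or.inr hx) (Or.inr hx')
  choose S hcS hTsub hSsub hSconn hScard using hTS
  refine ⟨fun i => ⋃ j, S i j, fun i => ⟨c i, Set.mem_iUnion.2 ⟨i, hcS i i⟩⟩, ?_, ?_, ?_, ?_⟩
  · intro i i' hne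
    refine Set.disjoint_left.2 fun x hx hx' => ?_
    obtain ⟨j, hj⟩ := Set.mem_iUnion.1 hx
    obtain ⟨j', hj'⟩ := Set.mem_iUnion.1 hx'
    have hmem : x ∈ ⋃ k, Q k := by
      rcases hSsub i j hj with h | h
      · rcases hSsub i' j' hj' with h' | h'
        · exact hTdisj i j i' j' hne x h h'
        · exact Set.mem_iUnion.2 ⟨i', h'⟩
      · exact Set.mem_iUnion.2 ⟨i, h⟩
    have hi : x ∈ Q i := (hSsub i j hj).elim (fun h => hTQ i j ⟨h, hmem⟩) id
    have hi' : x ∈ Q i' := (hSsub i' j' hj').elim (fun h => hTQ i' j' ⟨h, hmem⟩) id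
    exact Set.disjoint_left.1 (hQ hne) hi hi'
  · intro i
    have := SimpleGraph.induce_sUnion_connected_of_pairwise_not_disjoint (G := G)
      (S := Set.range (S i)) ⟨_, ⟨0, ht⟩, rfl⟩
      (by rintro _ _ ⟨j, rfl⟩ ⟨j', rfl⟩; exact ⟨c i, hcS i j, hcS i j'⟩)
      (by rintro _ ⟨j, rfl⟩; exact hSconn i j)
    rwa [Set.sUnion_range] at this
  · intro i j hij
    obtain ⟨y, hy, z, hz, hyz⟩ := (hYZ i j hij).exists_adj
    exact ⟨y, Set.mem_iUnion.2 ⟨j, hTsub i j (hT1 i j hij ▸ hy)⟩, z,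
      Set.mem_iUnion.2 ⟨i, hTsub j i (hT2 j i hij ▸ hz)⟩, hyz⟩
  · have hunion : (⋃ i, ⋃ j, S i j) =
        ⋃ p ∈ (Finset.univ : Finset (Fin t × Fin t)), S p.1 p.2 := by
      ext x
      simp
    rw [hunion]
    refine Nat.cast_le.2 ((Finset.set_ncard_biUnion_le _ _).trans ?_)
    refine (Finset.sum_le_sum fun p _ => hScard p.1 p.2).trans ?_
    simp [sq]

/-- If every core grows to more than half of the vertices, robustly under deleting vertices outside
the cores, then there is a small complete minor. -/
lemma hasKtMinorOfOrder_of_large_avoidBall [Finite V] {Q : Fin t → Set V} {c : Fin t → V}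
    {X : Set V} {N R : ℕ} (ht : 0 < t) (hR : 1 ≤ R) (hc : ∀ i, c i ∈ Q i)
    (hQ : Pairwise (Function.onFun Disjoint Q))
    (hcore : ∀ i, ∀ x ∈ Q i, ∃ Y ⊆ Q i, c i ∈ Y ∧ x ∈ Y ∧ (G.induce Y).Connected ∧ Y.ncard ≤ R)
    (hlarge : ∀ U : Set V, U.ncard ≤ t ^ 2 * (2 * (N + 1)) → Disjoint U (⋃ k, Q k) →
      ∀ i, Nat.card V < 2 * (avoidBall G (X ∪ U ∪ ⋃ k, Q k) (Q i) N).ncard) :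
    HasKtMinorOfOrder G t ((t ^ 2 * (N + 1 + R) : ℕ) : ℝ) := by
  refine hasKtMinorOfOrder_of_links ht hR hc hQ hcore fun U hU hUQ i j hij => ?_
  set F := X ∪ U ∪ ⋃ k, Q k with hF
  have hQF : (⋃ k, Q k) ⊆ F := Set.subset_union_right
  have hUF : U ⊆ F := fun x hx => Or.inl (Or.inr hx)
  have hinter : (avoidBall G F (Q i) N ∩ avoidBall G F (Q j) N).Nonempty := by
    by_contra hne
    rw [Set.not_nonempty_iff_eq_empty, ← Set.disjoint_iff_inter_eq_empty] at hne
    have h1 := Set.ncard_union_eq hne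
    have h2 := Set.ncard_le_card (avoidBall G F (Q i) N ∪ avoidBall G F (Q j) N)
    have h3 := hlarge U hU hUQ i
    have h4 := hlarge U hU hUQ j
    rw [← hF] at h3 h4
    omega
  obtain ⟨a, ha, b, hb, Y, Z, haY, hbZ, hY, hZ, hYN, hZN, hYZ, hYF, hZF, hadj⟩ :=
    exists_linked_of_avoidBall_inter ((Set.subset_iUnion Q i).trans hQF) (hQ hij.ne) hinter
  have hcap : ∀ {k : Fin t} {a : V} {Y : Set V}, a ∈ Q k → (∀ y ∈ Y, y ≠ a → y ∉ F) →
      Y ∩ ⋃ k, Q k ⊆ Q k := by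
    rintro k a Y ha hYF y ⟨hy, hyQ⟩
    by_cases hya : y = a
    · exact hya ▸ ha
    · exact absurd (hQF hyQ) (hYF y hy hya)
  have hdisj : ∀ {k : Fin t} {a : V} {Y : Set V}, a ∈ Q k → (∀ y ∈ Y, y ≠ a → y ∉ F) →
      Disjoint Y U := by
    intro k a Y ha hYF
    refine Set.disjoint_left.2 fun y hy hyU => ?_
    by_cases hya : y = a
    · exact Set.disjoint_left.1 hUQ hyU (Set.mem_iUnion.2 ⟨k, hya ▸ ha⟩)
    · exact hYF y hy hya (hUF hyU)
  exact ⟨Y, Z, ⟨hY, hZ, hYN, hZN, hYZ, hadj, ⟨a, haY, ha⟩, ⟨b, hbZ, hb⟩, hcap ha hYF, hcap hb hZF⟩,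
    Set.disjoint_union_left.2 ⟨hdisj ha hYF, hdisj hb hZF⟩⟩

end Links

section Growth

variable {V : Type*} {G : SimpleGraph V}

lemma two_rpow_mul_le_one_add_pow {x : ℝ} (hx : 0 ≤ x) (hx1 : x ≤ 1) (n : ℕ) :
    (2 : ℝ) ^ (x * n) ≤ (1 + x) ^ n := by
  rw [Real.rpow_mul zero_le_two, Real.rpow_natCast]
  gcongr
  have := rpow_one_add_le_one_add_mul_self (s := 1) (by norm_num) hx hx1
  rw [mul_one] at this
  norm_num at this ⊢
  exact this

/-- A ball grows exponentially as long as the forbidden set takes at most half of the neighbours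
provided by expansion. -/
lemma avoidBall_growth [Finite V] {F A : Set V} {γ M : ℝ} {T : ℕ} (hγ : 0 ≤ γ) (hγ2 : γ ≤ 2)
    (hexp : ∀ S : Set V, (S.ncard : ℝ) ≤ M → γ * S.ncard ≤ (nbhd G S).ncard)
    (hloss : ∀ n < T, ((nbhd G (avoidBall G F A n) ∩ F).ncard : ℝ) ≤
      γ / 2 * (avoidBall G F A n).ncard) :
    M < (avoidBall G F A T).ncard ∨
      A.ncard * (2 : ℝ) ^ (γ / 2 * T) ≤ (avoidBall G F A T).ncard := by
  have key : ∀ n ≤ T, M < (avoidBall G F A n).ncard ∨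
      A.ncard * (1 + γ / 2) ^ n ≤ ((avoidBall G F A n).ncard : ℝ) := by
    intro n
    induction n with
    | zero => exact fun _ => Or.inr (by simp [avoidBall])
    | succ n ih =>
      intro hn
      have hmono : ((avoidBall G F A n).ncard : ℝ) ≤ (avoidBall G F A (n + 1)).ncard :=
        Nat.cast_le.2 (Set.ncard_le_ncard (avoidBall_monotone n.le_succ))
      by_cases hM : M < (avoidBall G F A n).ncard
      · exact Or.inl (hM.trans_le hmono)
      · right
        have h1 := (ih (by omega)).resolve_left hM
        have h2 := hexp _ (not_lt.1 hM)
        have h3 := hloss n (by omega)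
        have h4 : ((avoidBall G F A n).ncard : ℝ) + (nbhd G (avoidBall G F A n)).ncard ≤
            (avoidBall G F A (n + 1)).ncard + (nbhd G (avoidBall G F A n) ∩ F).ncard := by
          exact_mod_cast ncard_avoidBall_succ n
        rw [pow_succ, ← mul_assoc]
        have h5 := mul_le_mul_of_nonneg_right h1 (by linarith : (0 : ℝ) ≤ 1 + γ / 2)
        linarith
  refine (key T le_rfl).imp_right fun h => le_trans ?_ h
  gcongr
  exact two_rpow_mul_le_one_add_pow (by linarith) (by linarith) T

/-- An expander `G` for which `L = log |V|` and `ℓ = log log |V|` are large compared to the other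
parameters. -/
structure IsLargeExpander (G : SimpleGraph V) (δ : ℝ) (t : ℕ) (L ℓ : ℝ) : Prop where
  two_rpow_L : (2 : ℝ) ^ L = Nat.card V
  two_rpow_l : (2 : ℝ) ^ ℓ = L
  expand : ∀ d : ℕ, (d : ℝ) ≤ ℓ - 1 → ∀ S : Set V, (S.ncard : ℝ) ≤ 2 ^ (L - (2 : ℝ) ^ d) →
    δ * 2 ^ d / (L * ℓ ^ 2) * S.ncard ≤ (nbhd G S).ncard
  one_le_mul : 1 ≤ δ * ℓ
  delta_le : δ ≤ ℓ
  t_le : (t : ℝ) ≤ ℓ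
  le_l : 1000 ≤ ℓ
  pow_le : ℓ ^ 20 ≤ L

namespace IsLargeExpander

variable {δ : ℝ} {t : ℕ} {L ℓ : ℝ}

lemma l_pos (h : IsLargeExpander G δ t L ℓ) : 0 < ℓ := by linarith [h.le_l]

lemma delta_pos (h : IsLargeExpander G δ t L ℓ) : 0 < δ :=
  pos_of_mul_pos_left (zero_lt_one.trans_le h.one_le_mul) h.l_pos.le

lemma pow_le_L (h : IsLargeExpander G δ t L ℓ) {k : ℕ} (hk : k ≤ 20) : ℓ ^ k ≤ L :=
  (pow_le_pow_right₀ (by linarith [h.le_l]) hk).trans h.pow_le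

lemma le_L (h : IsLargeExpander G δ t L ℓ) : 1000 ≤ L := by
  have := h.pow_le_L (k := 1) (by norm_num)
  linarith [h.le_l]

lemma L_pos (h : IsLargeExpander G δ t L ℓ) : 0 < L := by linarith [h.le_L]

lemma L_pow (h : IsLargeExpander G δ t L ℓ) (k : ℕ) : L ^ k = (2 : ℝ) ^ (k * ℓ) := by
  rw [mul_comm, Real.rpow_mul zero_le_two, h.two_rpow_l, Real.rpow_natCast]

lemma gamma_pos (h : IsLargeExpander G δ t L ℓ) (d : ℕ) : 0 < δ * 2 ^ d / (L * ℓ ^ 2) := by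
  have := h.delta_pos
  have := h.L_pos
  have := h.l_pos
  positivity

lemma two_pow_le (h : IsLargeExpander G δ t L ℓ) {d : ℕ} (hd : (d : ℝ) ≤ ℓ - 1) :
    (2 : ℝ) ^ d ≤ L / 2 := by
  rw [← Real.rpow_natCast]
  calc (2 : ℝ) ^ (d : ℝ) ≤ 2 ^ (ℓ - 1) := Real.rpow_le_rpow_of_exponent_le one_le_two hd
    _ = L / 2 := by rw [Real.rpow_sub_one two_ne_zero, h.two_rpow_l]

lemma le_two_pow_floor (h : IsLargeExpander G δ t L ℓ) : L / 4 ≤ (2 : ℝ) ^ ⌊ℓ - 1⌋₊ := by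
  rw [← Real.rpow_natCast]
  have h1 := (Nat.lt_floor_add_one (ℓ - 1)).le
  calc L / 4 = (2 : ℝ) ^ (ℓ - 2) := by
        rw [Real.rpow_sub zero_lt_two, h.two_rpow_l]; norm_num
    _ ≤ _ := Real.rpow_le_rpow_of_exponent_le one_le_two (by linarith)

lemma floor_le (h : IsLargeExpander G δ t L ℓ) : (⌊ℓ - 1⌋₊ : ℝ) ≤ ℓ - 1 :=
  Nat.floor_le (by linarith [h.le_l])

lemma gamma_le_two (h : IsLargeExpander G δ t L ℓ) {d : ℕ} (hd : (d : ℝ) ≤ ℓ - 1) :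
    δ * 2 ^ d / (L * ℓ ^ 2) ≤ 2 := by
  have h1 := h.L_pos
  have h2 := h.l_pos
  have h3 := h.le_l
  rw [div_le_iff₀ (by positivity)]
  calc δ * 2 ^ d ≤ ℓ * (L / 2) := mul_le_mul h.delta_le (h.two_pow_le hd) (by positivity) h2.le
    _ ≤ 2 * (L * ℓ ^ 2) := by nlinarith [mul_pos h1 h2]

/-- The number of steps in which a set robustly grows by one scale. -/
noncomputable def phaseLength (δ L ℓ : ℝ) : ℕ := ⌊8 * (L * ℓ ^ 2 / δ)⌋₊ + 1

/-- The number of steps in which a set robustly grows to more than half of the graph. -/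
noncomputable def growthLength (δ L ℓ : ℝ) : ℕ := phaseLength δ L ℓ * (⌊ℓ - 1⌋₊ + 1)

lemma lt_gamma_mul_phaseLength (h : IsLargeExpander G δ t L ℓ) (d : ℕ) :
    4 * (2 : ℝ) ^ d < δ * 2 ^ d / (L * ℓ ^ 2) / 2 * phaseLength δ L ℓ := by
  have h1 := h.L_pos
  have h2 := h.l_pos
  have h3 := h.delta_pos
  have hT : 8 * (L * ℓ ^ 2 / δ) < phaseLength δ L ℓ := by
    unfold phaseLength
    push_cast
    exact Nat.lt_floor_add_one _
  calc 4 * (2 : ℝ) ^ d = δ * 2 ^ d / (L * ℓ ^ 2) / 2 * (8 * (L * ℓ ^ 2 / δ)) := by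
        field_simp
        norm_num
    _ < _ := by
        have := h.gamma_pos d
        gcongr

lemma growthLength_le (h : IsLargeExpander G δ t L ℓ) :
    (growthLength δ L ℓ : ℝ) ≤ 9 * (L * ℓ ^ 3 / δ) := by
  have h1 := h.L_pos
  have h2 := h.l_pos
  have h3 := h.delta_pos
  have h4 := h.le_L
  have h5 := h.le_l
  have hone : 1 ≤ L * ℓ ^ 2 / δ := by
    rw [le_div_iff₀ h3, one_mul]
    calc δ ≤ 1 * ℓ := by linarith [h.delta_le]
      _ ≤ L * ℓ ^ 2 := by gcongr <;> nlinarith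
  have hT : (phaseLength δ L ℓ : ℝ) ≤ 9 * (L * ℓ ^ 2 / δ) := by
    unfold phaseLength
    push_cast
    linarith [Nat.floor_le (show 0 ≤ 8 * (L * ℓ ^ 2 / δ) by positivity)]
  unfold growthLength
  push_cast
  calc (phaseLength δ L ℓ : ℝ) * (⌊ℓ - 1⌋₊ + 1) ≤ 9 * (L * ℓ ^ 2 / δ) * ℓ := by
        gcongr
        linarith [h.floor_le]
    _ = 9 * (L * ℓ ^ 3 / δ) := by ring

/-- A set that is large compared to the forbidden set grows to more than half of the graph. -/
lemma card_lt_two_mul_ncard_avoidBall [Finite V] (h : IsLargeExpander G δ t L ℓ) {F A : Set V}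
    (hA : A.Nonempty) (hF : L ^ 2 * F.ncard ≤ (A.ncard : ℝ)) :
    Nat.card V < 2 * (avoidBall G F A (growthLength δ L ℓ)).ncard := by
  have hL := h.L_pos
  have hl := h.l_pos
  have hδ := h.delta_pos
  have hA1 : (1 : ℝ) ≤ A.ncard := Nat.one_le_cast.2 ((Set.ncard_pos A.toFinite).2 hA)
  have hFγ : ∀ d : ℕ, (F.ncard : ℝ) ≤ δ * 2 ^ d / (L * ℓ ^ 2) / 2 * A.ncard := by
    intro d
    have h1 : 1 / L ^ 2 ≤ δ * 2 ^ d / (L * ℓ ^ 2) / 2 := by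
      rw [div_div, div_le_div_iff₀ (by positivity) (by positivity)]
      have h2 : 2 * ℓ ^ 3 ≤ L := by
        have := h.pow_le_L (k := 4) (by norm_num)
        nlinarith [h.le_l, pow_pos hl 3]
      have h3 : (1 : ℝ) ≤ 2 ^ d := one_le_pow₀ one_le_two
      have h4 : 1 ≤ δ * ℓ * 2 ^ d := by nlinarith [h.one_le_mul]
      have h5 : 1 * (2 * ℓ ^ 3) ≤ δ * ℓ * 2 ^ d * L := by gcongr
      have h6 : 2 * ℓ ^ 2 ≤ δ * 2 ^ d * L := by
        refine le_of_mul_le_mul_right ?_ hl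
        linarith
      calc 1 * (L * ℓ ^ 2 * 2) = L * (2 * ℓ ^ 2) := by ring
        _ ≤ L * (δ * 2 ^ d * L) := by gcongr
        _ = δ * 2 ^ d * L ^ 2 := by ring
    calc (F.ncard : ℝ) = 1 / L ^ 2 * (L ^ 2 * F.ncard) := by field_simp
      _ ≤ _ := mul_le_mul h1 hF (by positivity) (by have := h.gamma_pos d; positivity)
  set T := phaseLength δ L ℓ with hT
  have hloss : ∀ (d r n : ℕ),
      ((nbhd G (avoidBall G F (avoidBall G F A r) n) ∩ F).ncard : ℝ) ≤
        δ * 2 ^ d / (L * ℓ ^ 2) / 2 * (avoidBall G F (avoidBall G F A r) n).ncard := by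
    intro d r n
    have h1 : ((nbhd G (avoidBall G F (avoidBall G F A r) n) ∩ F).ncard : ℝ) ≤ F.ncard :=
      Nat.cast_le.2 (Set.ncard_le_ncard Set.inter_subset_right)
    have h2 : (A.ncard : ℝ) ≤ (avoidBall G F (avoidBall G F A r) n).ncard :=
      Nat.cast_le.2 (Set.ncard_le_ncard ((subset_avoidBall r).trans (subset_avoidBall n)))
    have := h.gamma_pos d
    exact h1.trans ((hFγ d).trans (by gcongr))
  have key : ∀ k ≤ ⌊ℓ - 1⌋₊, (2 : ℝ) ^ (L - (2 : ℝ) ^ (⌊ℓ - 1⌋₊ - k)) <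
      (avoidBall G F A (T * (k + 1))).ncard := by
    intro k
    induction k with
    | zero =>
      intro _
      have h1 := avoidBall_growth (T := T) (h.gamma_pos ⌊ℓ - 1⌋₊).le (h.gamma_le_two h.floor_le)
        (h.expand _ h.floor_le) (fun n _ => hloss ⌊ℓ - 1⌋₊ 0 n)
      rw [avoidBall_add, zero_add] at h1
      rw [zero_add, mul_one, Nat.sub_zero]
      refine h1.elim id fun h1 => lt_of_lt_of_le ?_ h1
      have h2 := h.lt_gamma_mul_phaseLength ⌊ℓ - 1⌋₊
      have h3 := h.le_two_pow_floor
      calc (2 : ℝ) ^ (L - (2 : ℝ) ^ ⌊ℓ - 1⌋₊)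
          < (2 : ℝ) ^ (δ * 2 ^ ⌊ℓ - 1⌋₊ / (L * ℓ ^ 2) / 2 * T) := by
            refine Real.rpow_lt_rpow_of_exponent_lt one_lt_two ?_
            linarith
        _ = 1 * (2 : ℝ) ^ (δ * 2 ^ ⌊ℓ - 1⌋₊ / (L * ℓ ^ 2) / 2 * T) := (one_mul _).symm
        _ ≤ _ := by
            gcongr
            exact hA1
    | succ k ih =>
      intro hk
      obtain ⟨d, hd⟩ : ∃ d, ⌊ℓ - 1⌋₊ = d + (k + 1) := ⟨_, (Nat.sub_add_cancel hk).symm⟩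
      have hdl : (d : ℝ) ≤ ℓ - 1 := by
        refine le_trans ?_ h.floor_le
        exact_mod_cast (by omega : d ≤ ⌊ℓ - 1⌋₊)
      have h0 := ih (by omega)
      rw [show ⌊ℓ - 1⌋₊ - k = d + 1 by omega] at h0
      rw [show ⌊ℓ - 1⌋₊ - (k + 1) = d by omega]
      have h1 := avoidBall_growth (T := T) (h.gamma_pos d).le (h.gamma_le_two hdl)
        (h.expand _ hdl) (fun n _ => hloss d (T * (k + 1)) n)
      rw [avoidBall_add, ← mul_add_one] at h1
      refine h1.elim id fun h1 => lt_of_lt_of_le ?_ h1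
      have h2 := h.lt_gamma_mul_phaseLength d
      have h3 : (0 : ℝ) < 2 ^ d := by positivity
      calc (2 : ℝ) ^ (L - (2 : ℝ) ^ d)
          = (2 : ℝ) ^ (L - (2 : ℝ) ^ (d + 1)) * (2 : ℝ) ^ ((2 : ℝ) ^ d) := by
            rw [← Real.rpow_add zero_lt_two, pow_succ]
            ring_nf
        _ < _ := by
            refine mul_lt_mul h0 ?_ (by positivity) (by positivity)
            exact Real.rpow_le_rpow_of_exponent_le one_le_two (by linarith)
  have h1 := key _ le_rfl
  rw [Nat.sub_self, pow_zero, Real.rpow_sub_one two_ne_zero, h.two_rpow_L] at h1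
  have h2 : ((Nat.card V : ℕ) : ℝ) <
      ((2 * (avoidBall G F A (growthLength δ L ℓ)).ncard : ℕ) : ℝ) := by
    push_cast
    unfold growthLength
    linarith
  exact_mod_cast h2

/-- Small sets grow by a factor `1 + Ω(ℓ⁻³)` in every step. -/
lemma avoidBall_fast_growth [Finite V] (h : IsLargeExpander G δ t L ℓ) {F A : Set V} {T : ℕ}
    {s : ℝ} (hs : s ≤ L / 2) (hsT : s ≤ T / (8 * ℓ ^ 3)) (hA : A.Nonempty)
    (hloss : ∀ n < T, 8 * ℓ ^ 3 * ((nbhd G (avoidBall G F A n) ∩ F).ncard : ℝ) ≤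
      (avoidBall G F A n).ncard) :
    (2 : ℝ) ^ s ≤ (avoidBall G F A T).ncard := by
  have hL := h.L_pos
  have hl := h.l_pos
  have hδ := h.delta_pos
  have hl1 := h.le_l
  have hA1 : (1 : ℝ) ≤ A.ncard := Nat.one_le_cast.2 ((Set.ncard_pos A.toFinite).2 hA)
  have hγ : 1 / (4 * ℓ ^ 3) ≤ δ * 2 ^ ⌊ℓ - 1⌋₊ / (L * ℓ ^ 2) := by
    rw [div_le_div_iff₀ (by positivity) (by positivity)]
    have h1 : 1 * (L / 4) ≤ δ * ℓ * 2 ^ ⌊ℓ - 1⌋₊ :=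
      mul_le_mul h.one_le_mul h.le_two_pow_floor (by positivity) (by positivity)
    calc 1 * (L * ℓ ^ 2) = 4 * ℓ ^ 2 * (1 * (L / 4)) := by ring
      _ ≤ 4 * ℓ ^ 2 * (δ * ℓ * 2 ^ ⌊ℓ - 1⌋₊) := by gcongr
      _ = _ := by ring
  have h1 := avoidBall_growth (G := G) (F := F) (A := A) (γ := 1 / (4 * ℓ ^ 3))
    (M := (2 : ℝ) ^ (L - (2 : ℝ) ^ ⌊ℓ - 1⌋₊)) (T := T) (by positivity)
    (by
      rw [div_le_iff₀ (by positivity)]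
      nlinarith [one_le_pow₀ (n := 3) (by linarith : 1 ≤ ℓ)])
    (fun S hS => (mul_le_mul_of_nonneg_right hγ (by positivity)).trans (h.expand _ h.floor_le S hS))
    (fun n hn => by
      rw [div_div, one_div, ← div_eq_inv_mul, le_div_iff₀ (by positivity)]
      have := hloss n hn
      linarith)
  rcases h1 with h1 | h1
  · refine le_trans (Real.rpow_le_rpow_of_exponent_le one_le_two ?_) h1.le
    linarith [h.two_pow_le h.floor_le]
  · refine le_trans ?_ h1
    calc (2 : ℝ) ^ s ≤ 1 * (2 : ℝ) ^ (1 / (4 * ℓ ^ 3) / 2 * T) := by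
          rw [one_mul]
          refine Real.rpow_le_rpow_of_exponent_le one_le_two (hsT.trans_eq ?_)
          field_simp
          ring
      _ ≤ _ := by gcongr

end IsLargeExpander

end Growth

section Minors

variable {V : Type*} {G : SimpleGraph V}

lemma HasKtMinorOfOrder.mono {t : ℕ} {k k' : ℝ} (h : HasKtMinorOfOrder G t k) (hk : k ≤ k') :
    HasKtMinorOfOrder G t k' := by
  obtain ⟨P, h1, h2, h3, h4, h5⟩ := h
  exact ⟨P, h1, h2, h3, h4, h5.trans hk⟩

lemma ncard_iUnion_fin_le {t b : ℕ} {Q : Fin t → Set V} (hQ : ∀ i, (Q i).ncard ≤ b) :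
    (⋃ i, Q i).ncard ≤ t * b := by
  have h1 : (⋃ i, Q i) = ⋃ i ∈ (Finset.univ : Finset (Fin t)), Q i := by simp
  rw [h1]
  refine (Finset.set_ncard_biUnion_le _ _).trans ((Finset.sum_le_sum fun i _ => hQ i).trans ?_)
  simp

/-- Greedy choice of a family that is independent for a relation with small neighbourhoods. -/
lemma exists_pairwise_not [Finite V] {r : V → V → Prop} (hr : ∀ u v, r u v → r v u) {S : Set V}
    {b : ℕ} (hb : ∀ u ∈ S, {v | r u v}.ncard ≤ b) (k : ℕ) (hk : k * b < S.ncard) :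
    ∃ c : Fin k → V, (∀ i, c i ∈ S) ∧ Pairwise fun i j => ¬ r (c i) (c j) := by
  induction k with
  | zero => exact ⟨Fin.elim0, fun i => i.elim0, fun i => i.elim0⟩
  | succ k ih =>
    obtain ⟨c, hc, hcr⟩ := ih (lt_of_le_of_lt (Nat.mul_le_mul_right b k.le_succ) hk)
    have hU : (⋃ i, {v | r (c i) v}).ncard < S.ncard :=
      (ncard_iUnion_fin_le fun i => hb _ (hc i)).trans_lt
        (lt_of_le_of_lt (Nat.mul_le_mul_right b k.le_succ) hk)
    obtain ⟨v, hvS, hv⟩ := Set.exists_mem_notMem_of_ncard_lt_ncard hU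
    have hv' : ∀ i, ¬ r (c i) v := fun i hi => hv (Set.mem_iUnion.2 ⟨i, hi⟩)
    refine ⟨Fin.cons v c, Fin.cases hvS hc, ?_⟩
    intro i j hij
    induction i using Fin.cases with
    | zero =>
      induction j using Fin.cases with
      | zero => exact absurd rfl hij
      | succ j => exact fun h => hv' j (hr _ _ h)
    | succ i =>
      induction j using Fin.cases with
      | zero => exact hv' i
      | succ j => exact hcr fun h => hij (congrArg Fin.succ h)

namespace IsLargeExpander

variable {δ : ℝ} {t : ℕ} {L ℓ : ℝ}

lemma order_le (h : IsLargeExpander G δ t L ℓ) {r R : ℕ} (hr : (r : ℝ) ≤ ℓ ^ 12)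
    (hR : (R : ℝ) ≤ ℓ ^ 12) :
    ((t ^ 2 * (r + growthLength δ L ℓ + 1 + R) : ℕ) : ℝ) ≤ 10 * (t ^ 2 / δ) * L * ℓ ^ 3 := by
  have hL := h.L_pos
  have hl := h.l_pos
  have hδ := h.delta_pos
  have hl1 := h.le_l
  have h1 : 3 * ℓ ^ 12 ≤ L * ℓ ^ 3 / δ := by
    rw [le_div_iff₀ hδ]
    calc 3 * ℓ ^ 12 * δ ≤ ℓ * ℓ ^ 12 * ℓ := by
          gcongr
          · linarith
          · exact h.delta_le
      _ = ℓ ^ 11 * ℓ ^ 3 := by ring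
      _ ≤ L * ℓ ^ 3 := by gcongr; exact h.pow_le_L (by norm_num)
  have h2 : 1 ≤ ℓ ^ 12 := one_le_pow₀ (by linarith)
  have h3 := h.growthLength_le
  push_cast
  calc (t : ℝ) ^ 2 * (r + growthLength δ L ℓ + 1 + R) ≤ t ^ 2 * (10 * (L * ℓ ^ 3 / δ)) := by
        gcongr
        linarith
    _ = _ := by ring

lemma ncard_le_L_sq (h : IsLargeExpander G δ t L ℓ) {r u : ℕ} (hr : (r : ℝ) ≤ ℓ ^ 12)
    (hu : u ≤ t ^ 2 * (2 * (r + growthLength δ L ℓ + 1))) : (u : ℝ) ≤ L ^ 2 := by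
  have hL := h.L_pos
  have hl := h.l_pos
  have hδ := h.delta_pos
  have hl1 := h.le_l
  have h1 := h.order_le hr (R := 0) (by push_cast; positivity)
  have h2 : (u : ℝ) ≤ 2 * ((t ^ 2 * (r + growthLength δ L ℓ + 1 + 0) : ℕ) : ℝ) := by
    have : (u : ℝ) ≤ ((t ^ 2 * (2 * (r + growthLength δ L ℓ + 1)) : ℕ) : ℝ) := Nat.cast_le.2 hu
    push_cast at this ⊢
    linarith
  calc (u : ℝ) ≤ 2 * (10 * (t ^ 2 / δ) * L * ℓ ^ 3) := h2.trans (by gcongr)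
    _ ≤ 2 * (10 * (ℓ ^ 2 * ℓ) * L * ℓ ^ 3) := by
        have h3 := h.t_le
        have h4 : (t : ℝ) ^ 2 / δ ≤ ℓ ^ 2 * ℓ := by
          rw [div_le_iff₀ hδ]
          calc (t : ℝ) ^ 2 ≤ ℓ ^ 2 * 1 := by rw [mul_one]; gcongr
            _ ≤ ℓ ^ 2 * (δ * ℓ) := by gcongr; exact h.one_le_mul
            _ = _ := by ring
        gcongr
    _ = 20 * ℓ ^ 6 * L := by ring
    _ ≤ L * L := by
        gcongr
        refine le_trans ?_ (h.pow_le_L (k := 7) (by norm_num))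
        nlinarith [pow_pos hl 6]
    _ = L ^ 2 := by ring

/-- Stars at vertices of large degree can be connected to a complete minor. -/
lemma hasKtMinorOfOrder_of_large_degree [Finite V] (h : IsLargeExpander G δ t L ℓ) (ht : 0 < t)
    {c : Fin t → V} (hc : Function.Injective c) (hdeg : ∀ i, L ^ 5 ≤ (nbhd G {c i}).ncard) :
    HasKtMinorOfOrder G t (10 * (t ^ 2 / δ) * L * ℓ ^ 3) := by
  have hL := h.le_L
  have hl12 : 1 ≤ ℓ ^ 12 := one_le_pow₀ (by linarith [h.le_l])
  have hr : ((1 : ℕ) : ℝ) ≤ ℓ ^ 12 := by push_cast; exact hl12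
  refine (hasKtMinorOfOrder_of_large_avoidBall (G := G) (Q := fun i => {c i}) (c := c) (X := ∅)
    (N := 1 + growthLength δ L ℓ) (R := 1) ht le_rfl (fun i => rfl) ?_ ?_ ?_).mono
      (h.order_le hr hr)
  · exact fun i j hij => Set.disjoint_singleton.2 (hc.ne hij)
  · rintro i x rfl
    refine ⟨{c i}, subset_rfl, rfl, rfl, ?_, by simp⟩
    rw [SimpleGraph.induce_singleton_eq_top]
    exact SimpleGraph.connected_top
  · intro U hU _ i
    have hU2 := h.ncard_le_L_sq hr hU
    rw [← avoidBall_add]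
    refine h.card_lt_two_mul_ncard_avoidBall ⟨c i, subset_avoidBall 1 rfl⟩ ?_
    set F : Set V := ∅ ∪ U ∪ ⋃ k, {c k}
    have hF : (F.ncard : ℝ) ≤ 2 * L ^ 2 := by
      have h1 : F.ncard ≤ U.ncard + t * 1 := by
        refine (Set.ncard_union_le _ _).trans ?_
        rw [Set.empty_union]
        gcongr
        exact ncard_iUnion_fin_le fun i => (Set.ncard_singleton (c i)).le
      have h2 : (F.ncard : ℝ) ≤ U.ncard + t := by exact_mod_cast (by simpa using h1)
      have h3 := h.pow_le_L (k := 1) (by norm_num)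
      have h4 := h.t_le
      nlinarith
    have h1 := ncard_avoidBall_succ (G := G) (F := F) (A := {c i}) 0
    have h2 : (nbhd G (avoidBall G F {c i} 0) ∩ F).ncard ≤ F.ncard :=
      Set.ncard_le_ncard Set.inter_subset_right
    have h3 : ((nbhd G {c i}).ncard : ℝ) ≤ (avoidBall G F {c i} 1).ncard + F.ncard := by
      have : (nbhd G {c i}).ncard ≤ (avoidBall G F {c i} 1).ncard + F.ncard :=
        (Nat.le_add_left _ _).trans (h1.trans (by gcongr))
      exact_mod_cast this
    have h4 := hdeg i
    have h5 : L ^ 5 ≥ 1000 * L ^ 4 := by nlinarith [pow_pos h.L_pos 4]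
    have h6 : L ^ 4 ≥ L ^ 2 := pow_le_pow_right₀ (by linarith) (by norm_num)
    nlinarith [mul_le_mul_of_nonneg_left hF (sq_nonneg L)]

/-- If few vertices are deleted, then almost all vertices lie in components that are not small. -/
lemma ncard_setOf_small_avoidBall_le [Finite V] (h : IsLargeExpander G δ t L ℓ) {X : Set V}
    (hX : X.ncard ≤ t) {q : ℕ} (hq : (q : ℝ) ≤ ℓ ^ 12) :
    ({v | (avoidBall G X {v} q).ncard ≤ q}.ncard : ℝ) ≤ L ^ 3 := by
  have hL := h.le_L
  have hl := h.l_pos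
  by_contra hcon
  have hk : ⌈L ^ 3⌉₊ ≤ {v | (avoidBall G X {v} q).ncard ≤ q}.ncard :=
    Nat.ceil_le.2 (not_le.1 hcon).le
  obtain ⟨Z, hZ, hZk⟩ := Set.exists_subset_card_eq hk
  set S : Set V := ⋃ v ∈ Z.toFinite.toFinset, avoidBall G X {v} q with hS
  have hZS : Z ⊆ S := fun v hv =>
    Set.mem_biUnion (by simpa using hv) (subset_avoidBall q (Set.mem_singleton v))
  have hNS : nbhd G S ⊆ X := by
    rintro x ⟨hx, u, hu, hux⟩
    obtain ⟨v, hv, huv⟩ := Set.mem_iUnion₂.1 hu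
    have hvZ : v ∈ Z := by simpa using hv
    refine (nbhd_avoidBall_subset_or_lt_ncard (Set.singleton_nonempty v) q).resolve_right
      (not_le.2 (Nat.lt_succ_of_le (hZ hvZ))) ⟨fun hxv => hx (Set.mem_biUnion hv hxv), u, huv, hux⟩
  have hSle : (S.ncard : ℝ) ≤ 2 ^ (L - (2 : ℝ) ^ 0) := by
    have h1 : S.ncard ≤ ⌈L ^ 3⌉₊ * q := by
      refine (Finset.set_ncard_biUnion_le _ _).trans ?_
      refine (Finset.sum_le_sum (g := fun _ => q) fun v hv => ?_).trans ?_
      · exact hZ (by simpa using hv : v ∈ Z)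
      · rw [Finset.sum_const, smul_eq_mul, ← Set.ncard_eq_toFinset_card, hZk]
    have h2 : (S.ncard : ℝ) ≤ ⌈L ^ 3⌉₊ * q := by exact_mod_cast h1
    have h3 : (⌈L ^ 3⌉₊ : ℝ) ≤ L ^ 4 := by
      have := Nat.ceil_lt_add_one (pow_nonneg h.L_pos.le 3)
      nlinarith [one_le_pow₀ (n := 3) (by linarith : 1 ≤ L)]
    calc (S.ncard : ℝ) ≤ L ^ 4 * L := by
          refine h2.trans (mul_le_mul h3 (hq.trans (h.pow_le_L (by norm_num))) ?_ ?_) <;> positivity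
      _ = L ^ 5 := by ring
      _ = 2 ^ (5 * ℓ) := by rw [h.L_pow]; norm_num
      _ ≤ _ := by
          refine Real.rpow_le_rpow_of_exponent_le one_le_two ?_
          have := h.pow_le_L (k := 2) (by norm_num)
          nlinarith [h.le_l]
  have h1 := h.expand 0 (by push_cast; linarith [h.le_l]) S hSle
  have h2 : ((nbhd G S).ncard : ℝ) ≤ ℓ :=
    le_trans (by exact_mod_cast (Set.ncard_le_ncard hNS).trans hX) h.t_le
  have h3 : L ^ 3 ≤ S.ncard := by
    refine (Nat.le_ceil _).trans ?_
    rw [← hZk]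
    exact_mod_cast Set.ncard_le_ncard hZS
  have h4 : δ * 2 ^ 0 / (L * ℓ ^ 2) * L ^ 3 ≤ ℓ :=
    (mul_le_mul_of_nonneg_left h3 (h.gamma_pos 0).le).trans (h1.trans h2)
  have h5 : δ * L ^ 2 ≤ ℓ ^ 3 := by
    have hL0 := h.L_pos
    have : δ * 2 ^ 0 / (L * ℓ ^ 2) * L ^ 3 * ℓ ^ 2 ≤ ℓ * ℓ ^ 2 := by gcongr
    calc δ * L ^ 2 = δ * 2 ^ 0 / (L * ℓ ^ 2) * L ^ 3 * ℓ ^ 2 := by field_simp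
      _ ≤ _ := this
      _ = ℓ ^ 3 := by ring
  have h6 : L ^ 2 ≤ ℓ ^ 4 := by
    calc L ^ 2 = 1 * L ^ 2 := (one_mul _).symm
      _ ≤ δ * ℓ * L ^ 2 := by gcongr; exact h.one_le_mul
      _ = δ * L ^ 2 * ℓ := by ring
      _ ≤ ℓ ^ 3 * ℓ := by gcongr
      _ = ℓ ^ 4 := by ring
  nlinarith [h.pow_le_L (k := 4) (by norm_num)]

/-- If all degrees outside of a small set are bounded, then there are balls of small radius which
are far apart from each other, and they can be connected to a complete minor. -/
lemma hasKtMinorOfOrder_of_bounded_degree [Finite V] (h : IsLargeExpander G δ t L ℓ) (ht : 0 < t)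
    {X : Set V} (hX : X.ncard ≤ t) {Δ : ℕ} (hΔ : (Δ : ℝ) + 1 ≤ L ^ 6)
    (hdeg : ∀ u ∉ X, (nbhd G {u}).ncard ≤ Δ) :
    HasKtMinorOfOrder G t (10 * (t ^ 2 / δ) * L * ℓ ^ 3) := by
  have hL := h.le_L
  have hL0 := h.L_pos
  have hl := h.l_pos
  have hl1 := h.le_l
  have hpow : ∀ {a b : ℕ}, a ≤ b → ℓ ^ a ≤ ℓ ^ b := fun hab =>
    pow_le_pow_right₀ (by linarith) hab
  have hpow1 : ∀ a b : ℕ, a + 1 = b → 1000 * ℓ ^ a ≤ ℓ ^ b := by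
    rintro a _ rfl
    rw [pow_succ, mul_comm]
    gcongr
  have hXl : (X.ncard : ℝ) ≤ ℓ := le_trans (by exact_mod_cast hX) h.t_le
  have hball : ∀ v ∉ X, ∀ n, ((avoidBall G X {v} n).ncard : ℝ) ≤ (2 : ℝ) ^ (6 * ℓ * n) := by
    intro v hv n
    have h1 : ((avoidBall G X {v} n).ncard : ℝ) ≤ ((Δ : ℝ) + 1) ^ n := by
      exact_mod_cast ncard_avoidBall_singleton_le hv hdeg n
    calc ((avoidBall G X {v} n).ncard : ℝ) ≤ (L ^ 6) ^ n := h1.trans (by gcongr)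
      _ = (2 : ℝ) ^ (6 * ℓ * n) := by
          rw [h.L_pow, ← Real.rpow_natCast, ← Real.rpow_mul zero_le_two]
          norm_num
  obtain ⟨q, hq, hq'⟩ : ∃ q : ℕ, 8 * ℓ ^ 4 ≤ q ∧ (q : ℝ) < 8 * ℓ ^ 4 + 1 :=
    ⟨_, Nat.le_ceil _, Nat.ceil_lt_add_one (by positivity)⟩
  obtain ⟨p, hp, hp'⟩ : ∃ p : ℕ, ℓ ^ 5 ≤ p ∧ (p : ℝ) < ℓ ^ 5 + 1 :=
    ⟨_, Nat.le_ceil _, Nat.ceil_lt_add_one (by positivity)⟩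
  obtain ⟨r, hr, hr'⟩ : ∃ r : ℕ, ℓ ^ 11 ≤ r ∧ (r : ℝ) < ℓ ^ 11 + 1 :=
    ⟨_, Nat.le_ceil _, Nat.ceil_lt_add_one (by positivity)⟩
  have hone : ∀ a : ℕ, 1 ≤ ℓ ^ a := fun a => one_le_pow₀ (by linarith)
  have hqp : ((q + p : ℕ) : ℝ) + 1 ≤ ℓ ^ 6 := by
    push_cast
    linarith [hpow1 4 5 rfl, hpow1 5 6 rfl, hone 4]
  have hqpr : ((q + p + r : ℕ) : ℝ) ≤ ℓ ^ 12 := by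
    have : ((q + p + r : ℕ) : ℝ) = ((q + p : ℕ) : ℝ) + r := by push_cast; ring
    rw [this]
    linarith [hpow1 11 12 rfl, hone 11, hpow (show 6 ≤ 11 by norm_num)]
  have hr12 : (r : ℝ) ≤ ℓ ^ 12 := by linarith [hpow1 11 12 rfl, hone 11]
  have hq12 : (q : ℝ) ≤ ℓ ^ 12 := by
    linarith [hpow1 4 5 rfl, hone 4, hpow (show 5 ≤ 12 by norm_num)]
  -- centers of far apart balls
  obtain ⟨c, hc, hfar⟩ : ∃ c : Fin t → V, (∀ i, c i ∉ X ∧ q < (avoidBall G X {c i} q).ncard) ∧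
      ∀ i j, i ≠ j → Disjoint (avoidBall G X {c i} (q + p + r)) (avoidBall G X {c j} (q + p + r)) := by
    have hB : ∀ u ∈ {v | v ∉ X ∧ q < (avoidBall G X {v} q).ncard},
        {v | u ∉ X ∧ v ∉ X ∧ (avoidBall G X {u} (q + p + r) ∩
          avoidBall G X {v} (q + p + r)).Nonempty}.ncard ≤ ⌊(2 : ℝ) ^ (12 * ℓ ^ 13)⌋₊ := by
      rintro u ⟨hu, -⟩
      refine Nat.le_floor (le_trans ?_ ((hball u hu (q + p + r + (q + p + r))).trans ?_))
      · refine Nat.cast_le.2 (Set.ncard_le_ncard ?_)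
        rintro v ⟨-, hv, x, hxu, hxv⟩
        rw [← avoidBall_add]
        exact avoidBall_subset_avoidBall subset_rfl (Set.singleton_subset_iff.2 hxu) _
          (mem_avoidBall_singleton_comm hv hxv)
      · refine Real.rpow_le_rpow_of_exponent_le one_le_two ?_
        rw [Nat.cast_add]
        nlinarith
    have hlarge : t * ⌊(2 : ℝ) ^ (12 * ℓ ^ 13)⌋₊ <
        {v | v ∉ X ∧ q < (avoidBall G X {v} q).ncard}.ncard := by
      have h1 : Nat.card V ≤ {v | v ∉ X ∧ q < (avoidBall G X {v} q).ncard}.ncard + X.ncard +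
          {v | (avoidBall G X {v} q).ncard ≤ q}.ncard := by
        rw [← Set.ncard_univ]
        refine (Set.ncard_le_ncard (t := {v | v ∉ X ∧ q < (avoidBall G X {v} q).ncard} ∪ X ∪
          {v | (avoidBall G X {v} q).ncard ≤ q}) fun v _ => ?_).trans ?_
        · by_cases hvX : v ∈ X
          · exact Or.inl (Or.inr hvX)
          · rcases le_or_gt (avoidBall G X {v} q).ncard q with hv | hv
            · exact Or.inr hv
            · exact Or.inl (Or.inl ⟨hvX, hv⟩)
        · refine (Set.ncard_union_le _ _).trans ?_
          gcongr
          exact Set.ncard_union_le _ _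
      have h2 : (2 : ℝ) ^ L ≤ ({v | v ∉ X ∧ q < (avoidBall G X {v} q).ncard}.ncard : ℝ) + X.ncard +
          {v | (avoidBall G X {v} q).ncard ≤ q}.ncard := by
        rw [h.two_rpow_L]
        exact_mod_cast h1
      have h3 := h.ncard_setOf_small_avoidBall_le hX hq12
      have h4 : ((t * ⌊(2 : ℝ) ^ (12 * ℓ ^ 13)⌋₊ : ℕ) : ℝ) ≤ L * (2 : ℝ) ^ (12 * ℓ ^ 13) := by
        push_cast
        have := h.pow_le_L (k := 1) (by norm_num)
        exact mul_le_mul (by linarith [h.t_le]) (Nat.floor_le (by positivity)) (by positivity)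
          hL0.le
      have h5 : L ^ 4 * (2 : ℝ) ^ (12 * ℓ ^ 13) ≤ (2 : ℝ) ^ L := by
        rw [h.L_pow, ← Real.rpow_add zero_lt_two]
        refine Real.rpow_le_rpow_of_exponent_le one_le_two ?_
        push_cast
        have := h.pow_le_L (k := 14) (by norm_num)
        linarith [hpow1 13 14 rfl, hpow (show 1 ≤ 13 by norm_num)]
      have h6 : (1 : ℝ) ≤ (2 : ℝ) ^ (12 * ℓ ^ 13) :=
        Real.one_le_rpow one_le_two (by positivity)
      have h7 : ℓ ≤ L := by simpa using h.pow_le_L (k := 1) (by norm_num)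
      have h8 : L + L ^ 3 + L * (2 : ℝ) ^ (12 * ℓ ^ 13) < L ^ 4 * (2 : ℝ) ^ (12 * ℓ ^ 13) := by
        have e1 : L ≤ L ^ 3 := le_self_pow₀ (by linarith) (by norm_num)
        have e2 : 3 * L ^ 3 < L ^ 4 := by nlinarith [pow_pos hL0 3]
        have e3 : L ^ 3 ≤ L ^ 3 * (2 : ℝ) ^ (12 * ℓ ^ 13) := le_mul_of_one_le_right (by positivity) h6
        have e4 : L * (2 : ℝ) ^ (12 * ℓ ^ 13) ≤ L ^ 3 * (2 : ℝ) ^ (12 * ℓ ^ 13) := by gcongr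
        have e5 : 3 * L ^ 3 * (2 : ℝ) ^ (12 * ℓ ^ 13) < L ^ 4 * (2 : ℝ) ^ (12 * ℓ ^ 13) := by gcongr
        linarith
      have h9 : ((t * ⌊(2 : ℝ) ^ (12 * ℓ ^ 13)⌋₊ : ℕ) : ℝ) <
          ({v | v ∉ X ∧ q < (avoidBall G X {v} q).ncard}.ncard : ℝ) := by linarith
      exact_mod_cast h9
    obtain ⟨c, hc, hcr⟩ := exists_pairwise_not
      (fun u v huv => ⟨huv.2.1, huv.1, by rw [Set.inter_comm]; exact huv.2.2⟩) hB t hlarge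
    refine ⟨c, hc, fun i j hij => ?_⟩
    rw [Set.disjoint_iff_inter_eq_empty, ← Set.not_nonempty_iff_eq_empty]
    exact fun hne => hcr hij ⟨(hc i).1, (hc j).1, hne⟩
  have hQball : ∀ i, avoidBall G X {c i} (q + p) ⊆ avoidBall G X {c i} (q + p + r) := fun i =>
    avoidBall_monotone (Nat.le_add_right _ _)
  have hQlarge : ∀ i, L ^ 4 ≤ ((avoidBall G X {c i} (q + p)).ncard : ℝ) := by
    intro i
    have h1 := h.avoidBall_fast_growth (F := X) (A := avoidBall G X {c i} q) (T := p)
      (s := ℓ ^ 2 / 8) (by linarith [h.pow_le_L (k := 2) (by norm_num)])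
      (by
        rw [div_le_div_iff₀ (by norm_num) (by positivity)]
        linarith [show ℓ ^ 2 * (8 * ℓ ^ 3) = 8 * ℓ ^ 5 by ring])
      ⟨c i, subset_avoidBall q rfl⟩
      (fun n _ => by
        have e1 : ((nbhd G (avoidBall G X (avoidBall G X {c i} q) n) ∩ X).ncard : ℝ) ≤ ℓ :=
          le_trans (Nat.cast_le.2 (Set.ncard_le_ncard Set.inter_subset_right)) hXl
        have e2 : (q : ℝ) ≤ (avoidBall G X (avoidBall G X {c i} q) n).ncard :=
          Nat.cast_le.2 ((hc i).2.le.trans (Set.ncard_le_ncard (subset_avoidBall n)))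
        calc _ ≤ 8 * ℓ ^ 3 * ℓ := by gcongr
          _ = 8 * ℓ ^ 4 := by ring
          _ ≤ _ := hq.trans e2)
    rw [avoidBall_add] at h1
    refine le_trans ?_ h1
    rw [h.L_pow]
    refine Real.rpow_le_rpow_of_exponent_le one_le_two ?_
    push_cast
    nlinarith
  have hR12 : ((q + p + 1 : ℕ) : ℝ) ≤ ℓ ^ 12 := by
    rw [Nat.cast_add_one]
    exact hqp.trans (hpow (by norm_num))
  refine (hasKtMinorOfOrder_of_large_avoidBall (G := G)
    (Q := fun i => avoidBall G X {c i} (q + p)) (c := c) (X := X) (N := r + growthLength δ L ℓ)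
    (R := q + p + 1) ht (by omega) (fun i => subset_avoidBall _ rfl) ?_ ?_ ?_).mono
      (h.order_le hr12 hR12)
  · exact fun i j hij => (hfar i j hij).mono (hQball i) (hQball j)
  · intro i x hx
    obtain ⟨a, rfl, Y, hY, h1, h2, h3, -, h5, -⟩ := exists_connected_of_mem_avoidBall hx
    exact ⟨Y, hY, h1, h2, h3, h5⟩
  · intro U hU hUQ i
    have hU2 := h.ncard_le_L_sq hr12 hU
    have hXU : ((X ∪ U).ncard : ℝ) ≤ 2 * L ^ 2 := by
      have e1 : ((X ∪ U).ncard : ℝ) ≤ X.ncard + U.ncard := by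
        exact_mod_cast Set.ncard_union_le X U
      have e2 : ℓ ≤ L := by simpa using h.pow_le_L (k := 1) (by norm_num)
      nlinarith
    rw [← avoidBall_add]
    set F : Set V := X ∪ U ∪ ⋃ k, avoidBall G X {c k} (q + p) with hF
    have hXF : X ⊆ F := fun x hx => Or.inl (Or.inl hx)
    have hne : (avoidBall G X {c i} (q + p)).Nonempty := ⟨c i, subset_avoidBall _ rfl⟩
    refine h.card_lt_two_mul_ncard_avoidBall (hne.mono (subset_avoidBall r)) ?_
    have hloss : ∀ n < r, nbhd G (avoidBall G F (avoidBall G X {c i} (q + p)) n) ∩ F ⊆ X ∪ U := by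
      rintro n hn x ⟨⟨hx, y, hy, hyx⟩, hxF⟩
      rcases hxF with hxF | hxQ
      · exact hxF
      · obtain ⟨k, hk⟩ := Set.mem_iUnion.1 hxQ
        by_cases hki : k = i
        · subst hki
          exact absurd (subset_avoidBall n hk) hx
        · by_cases hxX : x ∈ X
          · exact Or.inl hxX
          · have hy' := avoidBall_subset_avoidBall hXF subset_rfl n hy
            rw [avoidBall_add] at hy'
            have hx' := avoidBall_monotone (by omega : q + p + n + 1 ≤ q + p + r)
              (mem_avoidBall_succ_of_adj hy' hyx hxX)
            exact absurd (hQball k hk) (Set.disjoint_left.1 (hfar i k (Ne.symm hki)) hx')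
    have hgrow := h.avoidBall_fast_growth (F := F) (A := avoidBall G X {c i} (q + p)) (T := r)
      (s := ℓ ^ 8 / 8) (by linarith [h.pow_le_L (k := 8) (by norm_num)])
      (by
        rw [div_le_div_iff₀ (by norm_num) (by positivity)]
        linarith [show ℓ ^ 8 * (8 * ℓ ^ 3) = 8 * ℓ ^ 11 by ring])
      hne
      (fun n hn => by
        have e1 : ((nbhd G (avoidBall G F (avoidBall G X {c i} (q + p)) n) ∩ F).ncard : ℝ) ≤
            2 * L ^ 2 := le_trans (Nat.cast_le.2 (Set.ncard_le_ncard (hloss n hn))) hXU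
        have e2 : ((avoidBall G X {c i} (q + p)).ncard : ℝ) ≤
            (avoidBall G F (avoidBall G X {c i} (q + p)) n).ncard :=
          Nat.cast_le.2 (Set.ncard_le_ncard (subset_avoidBall n))
        have e3 : 16 * ℓ ^ 3 ≤ L := by linarith [hpow1 3 4 rfl, h.pow_le_L (k := 4) (by norm_num), hone 3]
        calc _ ≤ 8 * ℓ ^ 3 * (2 * L ^ 2) := by gcongr
          _ = 16 * ℓ ^ 3 * L ^ 2 := by ring
          _ ≤ L * L ^ 2 := by gcongr
          _ = L ^ 3 := by ring
          _ ≤ L ^ 4 := pow_le_pow_right₀ (by linarith) (by norm_num)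
          _ ≤ _ := (hQlarge i).trans e2)
    refine le_trans ?_ hgrow
    have hQle : ∀ k, (avoidBall G X {c k} (q + p)).ncard ≤ ⌊(2 : ℝ) ^ (6 * ℓ ^ 7)⌋₊ := by
      intro k
      refine Nat.le_floor ((hball (c k) (hc k).1 (q + p)).trans ?_)
      refine Real.rpow_le_rpow_of_exponent_le one_le_two ?_
      nlinarith
    have hFle : (F.ncard : ℝ) ≤ 2 * L ^ 2 + L * (2 : ℝ) ^ (6 * ℓ ^ 7) := by
      have e1 : (F.ncard : ℝ) ≤ (X ∪ U).ncard + ((t * ⌊(2 : ℝ) ^ (6 * ℓ ^ 7)⌋₊ : ℕ) : ℝ) := by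
        exact_mod_cast (Set.ncard_union_le _ _).trans
          (Nat.add_le_add_left (ncard_iUnion_fin_le hQle) _)
      have e2 : ((t * ⌊(2 : ℝ) ^ (6 * ℓ ^ 7)⌋₊ : ℕ) : ℝ) ≤ L * (2 : ℝ) ^ (6 * ℓ ^ 7) := by
        push_cast
        have := h.pow_le_L (k := 1) (by norm_num)
        exact mul_le_mul (by linarith [h.t_le]) (Nat.floor_le (by positivity)) (by positivity)
          hL0.le
      linarith
    have hbig : (1 : ℝ) ≤ (2 : ℝ) ^ (6 * ℓ ^ 7) := Real.one_le_rpow one_le_two (by positivity)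
    calc L ^ 2 * F.ncard ≤ L ^ 2 * (2 * L ^ 2 + L * (2 : ℝ) ^ (6 * ℓ ^ 7)) := by gcongr
      _ ≤ L ^ 2 * (2 * L ^ 2 * (2 : ℝ) ^ (6 * ℓ ^ 7) + L ^ 2 * (2 : ℝ) ^ (6 * ℓ ^ 7)) := by
          have e1 : 2 * L ^ 2 ≤ 2 * L ^ 2 * (2 : ℝ) ^ (6 * ℓ ^ 7) :=
            le_mul_of_one_le_right (by positivity) hbig
          have e2 : L ≤ L ^ 2 := le_self_pow₀ (by linarith) (by norm_num)
          exact mul_le_mul_of_nonneg_left (add_le_add e1 (by gcongr)) (by positivity)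
      _ = 3 * L ^ 4 * (2 : ℝ) ^ (6 * ℓ ^ 7) := by ring
      _ ≤ L * L ^ 4 * (2 : ℝ) ^ (6 * ℓ ^ 7) := by gcongr; linarith
      _ = L ^ 5 * (2 : ℝ) ^ (6 * ℓ ^ 7) := by ring
      _ = (2 : ℝ) ^ (5 * ℓ + 6 * ℓ ^ 7) := by
          rw [h.L_pow, ← Real.rpow_add zero_lt_two]
          norm_num
      _ ≤ (2 : ℝ) ^ (ℓ ^ 8 / 8) := by
          refine Real.rpow_le_rpow_of_exponent_le one_le_two ?_
          linarith [hpow1 7 8 rfl, hpow (show 1 ≤ 7 by norm_num)]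

lemma hasKtMinorOfOrder [Finite V] (h : IsLargeExpander G δ t L ℓ) (ht : 0 < t) :
    HasKtMinorOfOrder G t (10 * (t ^ 2 / δ) * L * ℓ ^ 3) := by
  have hL := h.le_L
  set X : Set V := {v | L ^ 5 ≤ (nbhd G {v}).ncard} with hX
  rcases le_total t X.ncard with htX | htX
  · obtain ⟨Y, hYX, hY⟩ := Set.exists_subset_card_eq htX
    let e : Fin t ≃ Y := (finCongr hY.symm).trans (Finite.equivFin Y).symm
    exact h.hasKtMinorOfOrder_of_large_degree ht (c := fun i => (e i : V))
      (Subtype.val_injective.comp e.injective) fun i => hYX (e i).2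
  · refine h.hasKtMinorOfOrder_of_bounded_degree ht htX (Δ := ⌈L ^ 5⌉₊) ?_ fun u hu => ?_
    · have h1 := Nat.ceil_lt_add_one (pow_nonneg h.L_pos.le 5)
      have h2 : 1 ≤ L ^ 5 := one_le_pow₀ (by linarith)
      nlinarith
    · have h1 : ((nbhd G {u}).ncard : ℝ) ≤ ⌈L ^ 5⌉₊ := (not_le.1 hu).le.trans (Nat.le_ceil _)
      exact_mod_cast h1

end IsLargeExpander

lemma eventually_isLargeExpander {δ : ℝ} (hδ : 0 < δ) (t : ℕ) :
    ∀ᶠ m : ℕ in Filter.atTop, ∀ H : SimpleGraph (Fin m), IsDeltaExpander H δ →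
      IsLargeExpander H δ t (logb 2 m) (logb 2 (logb 2 m)) := by
  have hlog : Filter.Tendsto (logb 2) Filter.atTop Filter.atTop := tendsto_logb_atTop one_lt_two
  have hL : Filter.Tendsto (fun m : ℕ => logb 2 (m : ℝ)) Filter.atTop Filter.atTop :=
    hlog.comp tendsto_natCast_atTop_atTop
  have hl := hlog.comp hL
  have hpow : ∀ᶠ x : ℝ in Filter.atTop, logb 2 x ^ 20 ≤ x := by
    have h1 := (isLittleO_pow_logb_id_atTop (b := 2) (n := 20)).bound one_pos
    filter_upwards [h1, Filter.eventually_ge_atTop 0] with x hx hx0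
    rw [one_mul, id, Real.norm_of_nonneg hx0] at hx
    exact (le_abs_self _).trans hx
  filter_upwards [hL.eventually hpow, hL.eventually_gt_atTop 0, hl.eventually_ge_atTop δ,
    hl.eventually_ge_atTop (1 / δ), hl.eventually_ge_atTop (t : ℝ), hl.eventually_ge_atTop 1000,
    Filter.eventually_gt_atTop 0] with m h1 h2 h3 h4 h5 h6 h7 H hH
  have hm : (0 : ℝ) < m := Nat.cast_pos.2 h7
  have hmL : (2 : ℝ) ^ logb 2 (m : ℝ) = m := Real.rpow_logb zero_lt_two (by norm_num) hm
  refine ⟨by simpa using hmL, Real.rpow_logb zero_lt_two (by norm_num) h2, fun d hd S hS => ?_,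
    ?_, h3, h5, h6, h1⟩
  · have h8 := hH d (by simpa using hd) S (by
      rw [Real.rpow_sub zero_lt_two, hmL] at hS
      rw [Nat.card_fin, ← Real.rpow_natCast]
      exact_mod_cast hS)
    simpa using h8
  · rw [div_le_iff₀ hδ] at h4
    simpa [mul_comm] using h4

end Minors

/-- Lemma 3.2: every sufficiently large `δ`-expander on `m` vertices has a `K_t`-minor of
order `O((t²/δ)·log m·(log log m)³)`. -/
theorem stmt_4 :
    ∃ C : ℝ, 0 < C ∧
      ∀ δ : ℝ, 0 < δ → ∀ t : ℕ, 3 ≤ t → ∃ m₀ : ℕ,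
        ∀ m : ℕ, m₀ ≤ m → ∀ H : SimpleGraph (Fin m),
          IsDeltaExpander H δ →
            HasKtMinorOfOrder H t
              (C * (t ^ 2 / δ) * logb 2 m * (logb 2 (logb 2 m)) ^ 3) := by
  refine ⟨10, by norm_num, fun δ hδ t ht => ?_⟩
  obtain ⟨m₀, hm₀⟩ := Filter.eventually_atTop.1 (eventually_isLargeExpander hδ t)
  exact ⟨m₀, fun m hm H hH => (hm₀ m hm H hH).hasKtMinorOfOrder (by omega)⟩
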